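/- arXiv:2604.03845 — 4 statements merged into one kernel-verified Lean document; each statement's English description precedes it below -/
import Mathlib

section
/- Let C be a preadditive pretriangulated category (zero object, shift by ℤ with additive shift functors), and let C_Z be a preadditive category with a shift by ℤ with additive shift functors. Let i^* : C ⥤ C_Z and i_* : C_Z ⥤ C be additive functors commuting with the shifts, with an adjunction adj : i^* ⊣ i_* compatible with the shifts. Fix objects e ∈ C, 1_Z ∈ C_Z, an isomorphism ψ : 1_Z ≅ i^*(e), an object B ∈ C_Z, an object A ∈ C, a distinguished triangle i_*(B) --ε--> A --λ--> Q --∂--> (i_*(B))⟦1⟧, and d : ℤ. Define Φ_d : Hom_C(e, (i_* B)⟦d⟧) → Hom_{C_Z}(1_Z, B⟦d⟧) as the composite of the shift-commutation isomorphism Hom_C(e, (i_* B)⟦d⟧) ≅ Hom_C(e, i_*(B⟦d⟧)), the adjunction hom-equivalence Hom_C(e, i_*(B⟦d⟧)) ≅ Hom_{C_Z}(i^*(e), B⟦d⟧), and precomposition with ψ.hom. Let c : e → A⟦d⟧ satisfy c ≫ λ⟦d⟧ = 0, let Lift^d(c) := {c̃ : e → (i_*B)⟦d⟧ | c̃ ≫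 ε⟦d⟧ = c}, and let δ_{d−1} : Hom(e, Q⟦d−1⟧) → Hom(e, (i_*B)⟦d⟧) be the boundary map of the triangle. Then: (i) Φ_d is an isomorphism of abelian groups; (ii) Lift^d(c) is nonempty, and Φ_d restricts to a bijection from Lift^d(c) onto its image Loc^tor(c) ⊆ Hom_{C_Z}(1_Z, B⟦d⟧); (iii) Loc^tor(c) is a torsor under the subgroup Φ_d(im δ_{d−1}): the difference of any two of its elements lies in Φ_d(im δ_{d−1}), and adding any element of Φ_d(im δ_{d−1}) to an element of Loc^tor(c) stays in Loc^tor(c). -/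
open CategoryTheory Category Limits Pretriangulated

namespace CategoryTheory.Pretriangulated

variable {C : Type*} [Category C] [Preadditive C] [HasZeroObject C] [HasShift C ℤ]
  [∀ n : ℤ, (shiftFunctor C n).Additive] [Pretriangulated C]

lemma shift_mk_distinguished {T : Triangle C} (hT : T ∈ distTriang C) (d : ℤ) :
    Triangle.mk (d.negOnePow • T.mor₁⟦d⟧') (d.negOnePow • T.mor₂⟦d⟧')
      (d.negOnePow • T.mor₃⟦d⟧' ≫ (shiftFunctorComm C (1 : ℤ) d).hom.app T.obj₁) ∈ distTriang C :=
  Triangle.shift_distinguished T hT d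

lemma exists_comp_shift_mor₁_eq {T : Triangle C} (hT : T ∈ distTriang C) {e : C} (d : ℤ)
    (c : e ⟶ T.obj₂⟦d⟧) (hc : c ≫ T.mor₂⟦d⟧' = 0) :
    ∃ a : e ⟶ T.obj₁⟦d⟧, a ≫ T.mor₁⟦d⟧' = c := by
  obtain ⟨g, hg⟩ : ∃ g : e ⟶ T.obj₁⟦d⟧, c = g ≫ (d.negOnePow • T.mor₁⟦d⟧') :=
    Triangle.coyoneda_exact₂ _ (shift_mk_distinguished hT d) c (by
      change c ≫ (d.negOnePow • T.mor₂⟦d⟧') = 0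
      simp [Units.smul_def, hc])
  refine ⟨d.negOnePow • g, ?_⟩
  rw [hg]
  simp [Units.smul_def]

lemma connecting_comp_shift_mor₁ {T : Triangle C} (hT : T ∈ distTriang C) {e : C} (d' d : ℤ)
    (h : 1 + d' = d) (γ : e ⟶ T.obj₃⟦d'⟧) :
    ((γ ≫ T.mor₃⟦d'⟧') ≫ (shiftFunctorAdd' C (1 : ℤ) d' d h).inv.app T.obj₁) ≫
      T.mor₁⟦d⟧' = 0 := by
  rw [assoc, ← NatTrans.naturality, assoc, Functor.comp_map, ← Functor.map_comp_assoc,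
    comp_distTriang_mor_zero₃₁ _ hT]
  simp

lemma exists_connecting_eq {T : Triangle C} (hT : T ∈ distTriang C) {e : C} (d' d : ℤ)
    (h : 1 + d' = d) (a : e ⟶ T.obj₁⟦d⟧) (ha : a ≫ T.mor₁⟦d⟧' = 0) :
    ∃ γ : e ⟶ T.obj₃⟦d'⟧,
      (γ ≫ T.mor₃⟦d'⟧') ≫ (shiftFunctorAdd' C (1 : ℤ) d' d h).inv.app T.obj₁ = a := by
  have h' : d' + 1 = d := by omega
  obtain ⟨g, hg⟩ : ∃ g : e ⟶ T.obj₃⟦d'⟧,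
      a ≫ (shiftFunctorAdd' C d' 1 d h').hom.app T.obj₁ =
        g ≫ (d'.negOnePow • T.mor₃⟦d'⟧' ≫ (shiftFunctorComm C (1 : ℤ) d').hom.app T.obj₁) :=
    Triangle.coyoneda_exact₁ _ (shift_mk_distinguished hT d') _ (by
      change (a ≫ (shiftFunctorAdd' C d' 1 d h').hom.app T.obj₁) ≫
        (d'.negOnePow • T.mor₁⟦d'⟧')⟦(1 : ℤ)⟧' = 0
      have := (shiftFunctorAdd' C d' 1 d h').hom.naturality T.mor₁
      dsimp at this
      simp only [Units.smul_def, Functor.map_zsmul, Preadditive.comp_zsmul, assoc, ← this,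
        reassoc_of% ha, zero_comp, smul_zero])
  refine ⟨d'.negOnePow • g, ?_⟩
  rw [← cancel_mono ((shiftFunctorAdd' C d' 1 d h').hom.app T.obj₁), hg]
  simp [Units.smul_def, shiftFunctorComm_eq C _ _ _ h]

end CategoryTheory.Pretriangulated

/-- The localization torsor: with an adjunction `i^* ⊣ i_*` compatible with the
shifts, an identification `ψ : 1_Z ≅ i^*(e)`, a distinguished triangle
`i_*(B) --ε--> A --λ--> Q --∂--> (i_*B)⟦1⟧`, and a class `c` with `c ≫ λ⟦d⟧ = 0`:
(i) the adjunction identification `Φ_d` is an isomorphism of abelian groups; (ii) the set of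
supported refinements of `c` is nonempty and `Φ_d` restricts to a bijection onto its image
`Loc^tor(c)`; (iii) `Loc^tor(c)` is a torsor under `Φ_d(im δ_{d−1})`. -/
theorem stmt2
    {C : Type*} [Category C] [Preadditive C] [HasZeroObject C] [HasShift C ℤ]
    [∀ n : ℤ, (shiftFunctor C n).Additive] [Pretriangulated C]
    {CZ : Type*} [Category CZ] [Preadditive CZ] [HasShift CZ ℤ]
    [∀ n : ℤ, (shiftFunctor CZ n).Additive]
    (istar : C ⥤ CZ) (ilow : CZ ⥤ C) [istar.Additive] [ilow.Additive]
    [istar.CommShift ℤ] [ilow.CommShift ℤ]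
    (adj : istar ⊣ ilow)
    [NatTrans.CommShift adj.unit ℤ] [NatTrans.CommShift adj.counit ℤ]
    (e : C) (oneZ : CZ) (ψ : oneZ ≅ istar.obj e)
    (B : CZ) (A Q : C)
    (ε : ilow.obj B ⟶ A) (lam : A ⟶ Q) (bd : Q ⟶ (ilow.obj B)⟦(1 : ℤ)⟧)
    (hT : Triangle.mk ε lam bd ∈ distTriang C)
    (d : ℤ)
    (Φ : (e ⟶ (ilow.obj B)⟦d⟧) → (oneZ ⟶ B⟦d⟧))
    (hΦ : ∀ α, Φ α = ψ.hom ≫ (adj.homEquiv e (B⟦d⟧)).symm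
      (α ≫ (ilow.commShiftIso d).inv.app B))
    (c : e ⟶ A⟦d⟧) (hc : c ≫ (shiftFunctor C d).map lam = 0)
    (δ : (e ⟶ Q⟦d - 1⟧) → (e ⟶ (ilow.obj B)⟦d⟧))
    (hδ : ∀ γ, δ γ = (γ ≫ (shiftFunctor C (d - 1)).map bd) ≫
      (shiftFunctorAdd' C (1 : ℤ) (d - 1) d (by ring)).inv.app (ilow.obj B)) :
    ((∀ x y, Φ (x + y) = Φ x + Φ y) ∧ Function.Bijective Φ) ∧
    (({ct : e ⟶ (ilow.obj B)⟦d⟧ | ct ≫ (shiftFunctor C d).map ε = c}.Nonempty) ∧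
      Set.BijOn Φ {ct | ct ≫ (shiftFunctor C d).map ε = c}
        (Φ '' {ct | ct ≫ (shiftFunctor C d).map ε = c})) ∧
    ((∀ x ∈ Φ '' {ct | ct ≫ (shiftFunctor C d).map ε = c},
        ∀ y ∈ Φ '' {ct | ct ≫ (shiftFunctor C d).map ε = c},
          x - y ∈ Φ '' Set.range δ) ∧
      (∀ x ∈ Φ '' {ct | ct ≫ (shiftFunctor C d).map ε = c},
        ∀ g ∈ Φ '' Set.range δ,
          x + g ∈ Φ '' {ct | ct ≫ (shiftFunctor C d).map ε = c})) := by
  have hadd : ∀ x y, Φ (x + y) = Φ x + Φ y := fun x y => by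
    simp [hΦ, Adjunction.homEquiv_counit]
  have hbij : Function.Bijective Φ := by
    refine ⟨fun x y hxy => ?_, fun y => ?_⟩
    · rw [← cancel_mono ((ilow.commShiftIso d).inv.app B)]
      simpa [hΦ] using hxy
    · exact ⟨(adj.homEquiv e (B⟦d⟧)) (ψ.inv ≫ y) ≫ (ilow.commShiftIso d).hom.app B, by simp [hΦ]⟩
  refine ⟨⟨hadd, hbij⟩, ⟨?_, hbij.injective.injOn.bijOn_image⟩, ?_, ?_⟩
  · exact exists_comp_shift_mor₁_eq hT d c hc
  · rintro _ ⟨x, hx, rfl⟩ _ ⟨y, hy, rfl⟩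
    obtain ⟨γ, hγ⟩ := exists_connecting_eq hT (d - 1) d (by ring) (x - y) (by
      change (x - y) ≫ (shiftFunctor C d).map ε = 0
      rw [Preadditive.sub_comp, sub_eq_zero]
      exact hx.trans hy.symm)
    refine ⟨x - y, ⟨γ, (hδ γ).trans hγ⟩, ?_⟩
    rw [eq_sub_iff_add_eq, ← hadd, sub_add_cancel]
  · rintro _ ⟨x, hx, rfl⟩ _ ⟨_, ⟨γ, rfl⟩, rfl⟩
    refine ⟨x + δ γ, ?_, hadd _ _⟩
    have hzero := connecting_comp_shift_mor₁ hT (d - 1) d (by ring) γ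
    have hx' : x ≫ (shiftFunctor C d).map ε = c := hx
    rw [Set.mem_ofPred_eq, Preadditive.add_comp, hx', hδ]
    exact (congrArg (c + ·) hzero).trans (add_zero c)
end

section
/- Let C_X and C_{X'} be preadditive categories, each with a shift by ℤ whose shift functors are additive, and let g^* : C_X ⥤ C_{X'} be an additive functor commuting with the shifts. Fix objects e_X ∈ C_X and e_{X'} ∈ C_{X'} with an isomorphism ρ : e_{X'} ≅ g^*(e_X); objects A, S ∈ C_X with a morphism ε : S → A; an object S' ∈ C_{X'} with a morphism ε' : S' → g^*(A); and a morphism γ : g^*(S) → S' satisfying γ ≫ ε' = g^*(ε). For d : ℤ and c : e_X → A⟦d⟧ define g^*c : e_{X'} → (g^*A)⟦d⟧ as ρ.hom ≫ g^*(c) composed with the shift-commutation isomorphism. Then the map ĝ : Hom(e_X, S⟦d⟧) → Hom(e_{X'}, S'⟦d⟧), α ↦ ρ.hom ≫ g^*(α) ≫ (shift-commutation) ≫ γ⟦d⟧, is a homomorphism of abelian groups, and for every c̃ with c̃ ≫ ε⟦d⟧ = c one has ĝ(c̃) ≫ ε'⟦d⟧ = g^*c; in particular ĝ carries the set of supported refinements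 of c into the set of supported refinements of g^*c. -/
open CategoryTheory Category Limits

/-- Cartesian base change: for an additive shift-commuting pullback functor
`g^*` and a counit-compatible Beck–Chevalley morphism `γ : g^*(S) ⟶ S'`
(i.e. `γ ≫ ε' = g^*(ε)`), the transport map `ĝ` on supported classes is additive and carries
supported refinements of `c` to supported refinements of `g^*c`. -/
theorem stmt6
    {CX : Type*} [Category CX] [Preadditive CX] [HasShift CX ℤ]
    [∀ n : ℤ, (shiftFunctor CX n).Additive]
    {CX' : Type*} [Category CX'] [Preadditive CX'] [HasShift CX' ℤ]
    [∀ n : ℤ, (shiftFunctor CX' n).Additive]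
    (gstar : CX ⥤ CX') [gstar.Additive] [gstar.CommShift ℤ]
    (eX : CX) (eX' : CX') (ρ : eX' ≅ gstar.obj eX)
    (A S : CX) (ε : S ⟶ A)
    (S' : CX') (ε' : S' ⟶ gstar.obj A)
    (γ : gstar.obj S ⟶ S') (hγ : γ ≫ ε' = gstar.map ε)
    (d : ℤ) (c : eX ⟶ A⟦d⟧)
    (gc : eX' ⟶ (gstar.obj A)⟦d⟧)
    (hgc : gc = ρ.hom ≫ gstar.map c ≫ (gstar.commShiftIso d).hom.app A)
    (ghat : (eX ⟶ S⟦d⟧) → (eX' ⟶ S'⟦d⟧))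
    (hghat : ∀ α, ghat α = ρ.hom ≫ gstar.map α ≫ (gstar.commShiftIso d).hom.app S ≫
      (shiftFunctor CX' d).map γ) :
    (∀ α α', ghat (α + α') = ghat α + ghat α') ∧
    (∀ ct : eX ⟶ S⟦d⟧, ct ≫ (shiftFunctor CX d).map ε = c →
      ghat ct ≫ (shiftFunctor CX' d).map ε' = gc) := by
  refine ⟨fun α α' => ?_, ?_⟩
  · simp only [hghat, Functor.map_add, Preadditive.add_comp, Preadditive.comp_add]
  · rintro ct rfl
    have naturality := (gstar.commShiftIso d).hom.naturality ε
    dsimp only [Functor.comp_obj, Functor.comp_map] at naturality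
    rw [hghat, hgc]
    simp only [assoc, Functor.map_comp]
    rw [naturality, ← hγ, Functor.map_comp]
end

section
/- Let C_X and C_Y be preadditive categories, each with a shift by ℤ whose shift functors are additive. Let p^* : C_Y ⥤ C_X and p_* : C_X ⥤ C_Y be additive functors commuting with the shifts, with an adjunction adj : p^* ⊣ p_* compatible with the shifts; write η for its unit and ε^p for its counit. Fix objects e_Y ∈ C_Y, e_X ∈ C_X with an isomorphism π : p^*(e_Y) ≅ e_X; an object A ∈ C_Y; an object S ∈ C_X with a morphism ε_S : S → p^*(A); an object K ∈ C_Y with a morphism ε_K : K → A; and a morphism θ : p_*(S) → K satisfying θ ≫ ε_K = p_*(ε_S) ≫ ε^p_A. For d : ℤ and c : e_X → (p^*A)⟦d⟧, define the pushforward p_♯c : e_Y → A⟦d⟧ as the composite η_{e_Y} ≫ p_*(π.hom) ≫ p_*(c) ≫ (shift-commutation isomorphism p_*((p^*A)⟦d⟧) ≅ (p_*p^*A)⟦d⟧) ≫ (ε^p_A)⟦d⟧. Then for every c̃ : e_X → S⟦d⟧ with c̃ ≫ (ε_S)⟦d⟧ = c, the morphism c̃' := η_{e_Y} ≫ p_*(π.hom)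 ≫ p_*(c̃) ≫ (shift-commutation) ≫ θ⟦d⟧ : e_Y → K⟦d⟧ satisfies c̃' ≫ (ε_K)⟦d⟧ = p_♯c; i.e., pushing forward a supported refinement of c yields a supported refinement of p_♯c. -/
open CategoryTheory Category Limits

/-- Proper pushforward: given an adjunction `p^* ⊣ p_*` compatible with the
shifts (with unit `η`), the transformation `ε^p : p_*p^* ⟶ 𝟭` used to define pushforward
(denoted "the counit" in the paper; it is taken here as a shift-compatible natural
transformation, which is the only type-correct reading of the map `p_*p^*A → A`),
an identification `π : p^*(e_Y) ≅ e_X`, and a comparison morphism `θ : p_*(S) ⟶ K` compatible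
with the counits (`θ ≫ ε_K = p_*(ε_S) ≫ ε^p_A`), pushing forward a supported refinement `c̃`
of `c` yields a supported refinement `c̃'` of the pushforward class `p_♯c`:
`c̃' ≫ (ε_K)⟦d⟧ = p_♯c`. -/
theorem stmt7
    {CX : Type*} [Category CX] [Preadditive CX] [HasShift CX ℤ]
    [∀ n : ℤ, (shiftFunctor CX n).Additive]
    {CY : Type*} [Category CY] [Preadditive CY] [HasShift CY ℤ]
    [∀ n : ℤ, (shiftFunctor CY n).Additive]
    (pstar : CY ⥤ CX) (plow : CX ⥤ CY) [pstar.Additive] [plow.Additive]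
    [pstar.CommShift ℤ] [plow.CommShift ℤ]
    (adj : pstar ⊣ plow)
    [NatTrans.CommShift adj.unit ℤ] [NatTrans.CommShift adj.counit ℤ]
    (εp : pstar ⋙ plow ⟶ 𝟭 CY) [NatTrans.CommShift εp ℤ]
    (eY : CY) (eX : CX) (π : pstar.obj eY ≅ eX)
    (A : CY)
    (S : CX) (εS : S ⟶ pstar.obj A)
    (K : CY) (εK : K ⟶ A)
    (θ : plow.obj S ⟶ K) (hθ : θ ≫ εK = plow.map εS ≫ εp.app A)
    (d : ℤ) (c : eX ⟶ (pstar.obj A)⟦d⟧) :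
    ∀ ct : eX ⟶ S⟦d⟧, ct ≫ (shiftFunctor CX d).map εS = c →
      (adj.unit.app eY ≫ plow.map π.hom ≫ plow.map ct ≫
          (plow.commShiftIso d).hom.app S ≫ (shiftFunctor CY d).map θ) ≫
        (shiftFunctor CY d).map εK
      = adj.unit.app eY ≫ plow.map π.hom ≫ plow.map c ≫
          (plow.commShiftIso d).hom.app (pstar.obj A) ≫
          (shiftFunctor CY d).map (εp.app A) := by
  rintro ct rfl
  have hnat := (plow.commShiftIso d).hom.naturality εS
  simp only [Functor.comp_map] at hnat
  simp only [assoc, Functor.map_comp, reassoc_of% hnat]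
  simp only [← Functor.map_comp, hθ]
end

section
/- Let C_X and C_Y be preadditive categories with zero objects and finite biproducts, each with a shift by ℤ whose shift functors are additive. Let p^* : C_Y ⥤ C_X and p_* : C_X ⥤ C_Y be additive functors commuting with the shifts, with an adjunction p^* ⊣ p_* compatible with the shifts (unit η, counit ε^p). Fix objects e_Y, e_X with an isomorphism π : p^*(e_Y) ≅ e_X, an object A ∈ C_Y, a finite index type Λ, objects S_λ ∈ C_X with morphisms ε_λ : S_λ → p^*(A) for each λ ∈ Λ, and let S := ⊕_{λ∈Λ} S_λ with ε_S : S → p^*(A) the morphism determined by ι_λ ≫ ε_S = ε_λ for all λ. For d : ℤ, let c : e_X → (p^*A)⟦d⟧ and let c̃ : e_X → S⟦d⟧ satisfy c̃ ≫ (ε_S)⟦d⟧ = c; set c̃_λ := c̃ ≫ (π_λ)⟦d⟧ : e_X → S_λ⟦d⟧, where π_λ : S → S_λ is the biproduct projection. Define, for each λ, θ_λ := p_*(ε_λ) ≫ ε^p_A : p_*(S_λ) → A, the global index p_♯c := η_{e_Y} ≫ p_*(π.hom) ≫ p_*(c) ≫ (shift-commutation) ≫ (ε^p_A)⟦d⟧,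 and local indices I_λ(c̃_λ) := η_{e_Y} ≫ p_*(π.hom) ≫ p_*(c̃_λ) ≫ (shift-commutation) ≫ (θ_λ)⟦d⟧. Then: (a) c = Σ_{λ∈Λ} (c̃_λ ≫ (ε_λ)⟦d⟧); and (b) p_♯c = Σ_{λ∈Λ} I_λ(c̃_λ). -/
open CategoryTheory Category Limits

/-- Additivity of the global-to-local index over a finite decomposition:
with an adjunction `p^* ⊣ p_*` compatible with the shifts (unit `η`), the transformation
`ε^p : p_*p^* ⟶ 𝟭` used to define the index maps (denoted "the counit" in the paper; taken
here as a shift-compatible natural transformation, the only type-correct reading of the map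
`p_*p^*A → A`), a finite family `S_λ` with `ε_λ : S_λ ⟶ p^*(A)`, `S = ⊕_λ S_λ`, `ε_S`
determined by `ι_λ ≫ ε_S = ε_λ`, and a supported refinement `c̃` of `c` with components
`c̃_λ = c̃ ≫ (π_λ)⟦d⟧`: (a) `c` is the sum of the `c̃_λ ≫ (ε_λ)⟦d⟧`, and (b) the global index
`p_♯c` is the sum of the local indices `I_λ(c̃_λ)`. -/
theorem stmt11
    {CX : Type*} [Category CX] [Preadditive CX] [HasZeroObject CX] [HasFiniteBiproducts CX]
    [HasShift CX ℤ] [∀ n : ℤ, (shiftFunctor CX n).Additive]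
    {CY : Type*} [Category CY] [Preadditive CY] [HasZeroObject CY] [HasFiniteBiproducts CY]
    [HasShift CY ℤ] [∀ n : ℤ, (shiftFunctor CY n).Additive]
    (pstar : CY ⥤ CX) (plow : CX ⥤ CY) [pstar.Additive] [plow.Additive]
    [pstar.CommShift ℤ] [plow.CommShift ℤ]
    (adj : pstar ⊣ plow)
    [NatTrans.CommShift adj.unit ℤ] [NatTrans.CommShift adj.counit ℤ]
    (εp : pstar ⋙ plow ⟶ 𝟭 CY) [NatTrans.CommShift εp ℤ]
    (eY : CY) (eX : CX) (π : pstar.obj eY ≅ eX)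
    (A : CY)
    (Λ : Type) [Fintype Λ]
    (Sl : Λ → CX) (εl : ∀ l : Λ, Sl l ⟶ pstar.obj A)
    (εS : (⨁ Sl) ⟶ pstar.obj A)
    (hεS : ∀ l : Λ, biproduct.ι Sl l ≫ εS = εl l)
    (d : ℤ)
    (c : eX ⟶ (pstar.obj A)⟦d⟧)
    (ct : eX ⟶ (⨁ Sl)⟦d⟧)
    (hct : ct ≫ (shiftFunctor CX d).map εS = c) :
    (c = ∑ l : Λ,
        (ct ≫ (shiftFunctor CX d).map (biproduct.π Sl l)) ≫ (shiftFunctor CX d).map (εl l)) ∧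
    (adj.unit.app eY ≫ plow.map π.hom ≫ plow.map c ≫
        (plow.commShiftIso d).hom.app (pstar.obj A) ≫
        (shiftFunctor CY d).map (εp.app A)
      = ∑ l : Λ,
        adj.unit.app eY ≫ plow.map π.hom ≫
          plow.map (ct ≫ (shiftFunctor CX d).map (biproduct.π Sl l)) ≫
          (plow.commShiftIso d).hom.app (Sl l) ≫
          (shiftFunctor CY d).map (plow.map (εl l) ≫ εp.app A)) := by
  have hε : εS = ∑ l : Λ, biproduct.π Sl l ≫ εl l := by
    apply biproduct.hom_ext'
    intro l
    classical
    rw [hεS, Preadditive.comp_sum, Finset.sum_eq_single l]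
    · simp
    · intro j _ hj
      rw [biproduct.ι_π_ne_assoc _ hj.symm, zero_comp]
    · simp
  have hc : c = ∑ l : Λ,
      (ct ≫ (shiftFunctor CX d).map (biproduct.π Sl l)) ≫ (shiftFunctor CX d).map (εl l) := by
    rw [← hct, hε, Functor.map_sum, Preadditive.comp_sum]
    simp only [Functor.map_comp, assoc]
  refine ⟨hc, ?_⟩
  rw [hc, Functor.map_sum, Preadditive.sum_comp, Preadditive.comp_sum, Preadditive.comp_sum]
  refine Finset.sum_congr rfl fun l _ => ?_
  rw [plow.map_comp (ct ≫ _), assoc, plow.commShiftIso_hom_naturality_assoc,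
    ← (shiftFunctor CY d).map_comp]
end
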